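/- arXiv:1901.10801 — 7 statements merged into one kernel-verified Lean document; each statement's English description precedes it below -/
import Mathlib

section
/- Let H be an arbitrary order-T tensor of dimension M in each mode, and let F ∈ ℝ^{M×M} be invertible. Then there exist a rank R ≥ 1 and a generalized shallow network with rectifier nonlinearity of rank R (weights λ_1,…,λ_R ∈ ℝ and vectors v_r^{(t)} ∈ ℝ^M) whose grid tensor with respect to F equals H, i.e. ∑_{r=1}^R λ_r · max( (F v_r^{(1)})_{i_1}, …, (F v_r^{(T)})_{i_T}, 0 ) = H_{i_1…i_T} for all (i_1,…,i_T) ∈ {1,…,M}^T. -/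
/-- Standard inner product on `ℝ^M`. -/
noncomputable def ip {M : ℕ} (a b : Fin M → ℝ) : ℝ := ∑ m, a m * b m

/-- The rectified maximum of finitely many indicators of failure of `p` is the indicator of
`∃ t, ¬ p t`. -/
theorem fold_max_indicator {ι : Type*} [Fintype ι] (p : ι → Prop) [DecidablePred p]
    [Decidable (∀ t, p t)] :
    (Finset.univ : Finset ι).fold max (0 : ℝ) (fun t => if p t then 0 else 1)
      = if ∀ t, p t then 0 else 1 := by
  apply le_antisymm
  · rw [Finset.fold_max_le]
    refine ⟨by split_ifs <;> norm_num, fun t _ => ?_⟩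
    split_ifs with h₁ h₂ h₂
    · exact le_rfl
    · exact zero_le_one
    · exact absurd (h₂ t) h₁
    · exact le_rfl
  · rw [Finset.le_fold_max]
    split_ifs with h
    · exact Or.inl le_rfl
    · obtain ⟨t, ht⟩ := not_forall.mp h
      exact Or.inr ⟨t, Finset.mem_univ t, by simp [ht]⟩

theorem ip_inv_mulVec {M : ℕ} (F : Matrix (Fin M) (Fin M) ℝ) (hF : IsUnit F.det)
    (u : Fin M → ℝ) (m : Fin M) : ip (F m) (F⁻¹.mulVec u) = u m := by
  change F.mulVec (F⁻¹.mulVec u) m = u m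
  rw [Matrix.mulVec_mulVec, Matrix.mul_nonsing_inv F hF, Matrix.one_mulVec]

/-- Universality, shallow part: for any order-`T` grid tensor `H` of
dimension `M` in each mode and any invertible feature matrix `F`, there is a generalized
shallow network with rectifier nonlinearity (some rank `Rk ≥ 1`, weights `lam r`,
vectors `v r t`) whose grid tensor equals `H`:
`∑_{r<Rk} λ_r · max((F v_r^{(1)})_{i_1}, …, (F v_r^{(T)})_{i_T}, 0) = H_{i_1…i_T}`.
The `T`-ary maximum together with `0` is written as `Finset.fold max 0`. -/
theorem shallow_relu_universality (T M : ℕ) (hT : 1 ≤ T) (hM : 1 ≤ M)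
    (F : Matrix (Fin M) (Fin M) ℝ) (hF : IsUnit F.det)
    (H : (Fin T → Fin M) → ℝ) :
    ∃ Rk : ℕ, 1 ≤ Rk ∧ ∃ (lam : ℕ → ℝ) (v : ℕ → ℕ → Fin M → ℝ),
      ∀ i : Fin T → Fin M,
        ∑ r ∈ Finset.range Rk,
            lam r * (Finset.univ : Finset (Fin T)).fold max 0
              (fun t => ip (F (i t)) (v r t.1))
          = H i := by
  classical
  let e := Fintype.equivFin (Option (Fin T → Fin M))
  let coeff : Option (Fin T → Fin M) → ℝ := fun o => o.elim (∑ j, H j) (fun j => -H j)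
  -- `none` gives the constant tensor `1`, and `some j` the tensor vanishing exactly at `j`
  let u : Option (Fin T → Fin M) → Fin T → Fin M → ℝ :=
    fun o t m => if o.map (fun j => j t) = some m then 0 else 1
  refine ⟨Fintype.card (Option (Fin T → Fin M)), Fintype.card_pos,
    fun r => if h : r < Fintype.card (Option (Fin T → Fin M)) then coeff (e.symm ⟨r, h⟩) else 0,
    fun r t => if h : r < Fintype.card (Option (Fin T → Fin M)) ∧ t < T then
      F⁻¹.mulVec (u (e.symm ⟨r, h.1⟩) ⟨t, h.2⟩) else 0, fun i => ?_⟩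
  have : Nonempty (Fin T) := ⟨⟨0, hT⟩⟩
  rw [Finset.sum_range]
  simp only [Fin.is_lt, and_self, dite_true, Fin.eta, ip_inv_mulVec F hF, u]
  rw [e.symm.sum_comp (fun o => coeff o * (Finset.univ : Finset (Fin T)).fold max 0
    (fun t => if o.map (fun j => j t) = some (i t) then 0 else 1))]
  simp only [fold_max_indicator, Fintype.sum_option, coeff, Option.map_none, Option.map_some,
    Option.some.injEq, Option.elim, reduceCtorEq, forall_const, if_false, mul_one]
  simp only [← funext_iff]
  rw [← Finset.sum_add_distrib, Finset.sum_eq_single i]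
  · simp
  · intro j _ hj
    simp [hj]
  · simp
end

section
/- Let H be an arbitrary order-T tensor of dimension M in each mode, and let F ∈ ℝ^{M×M} be invertible. Then there exists a generalized RNN with rectifier nonlinearity ξ(x,y) = max(x,y,0) whose grid tensor with respect to F equals H. -/
/-- The rectifier nonlinearity `ξ(x, y) = max(x, y, 0)`. -/
noncomputable def relu2 (x y : ℝ) : ℝ := max (max x y) 0

/-- Hidden states of a generalized RNN with `ξ`-nonlinearity `xi`, initial hidden state
`u`, input dimension `L`, hidden ranks `R`, input matrices `C` (`C t i` is the `i`-th row
of `C^{(t+1)}`), cores `G` (`G t i j k` is the entry `G^{(t+1)}_{ijk}`), feature matrix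
`F` (whose `i`-th row is the feature vector of template `i`), on the input sequence of
templates `idx`.  `rnnHidden … t j` is the `j`-th entry of `h^{(t)}`; entries with
`j ≥ R t` are junk and are never read by the recursion. -/
noncomputable def rnnHidden (M : ℕ) (xi : ℝ → ℝ → ℝ) (u : ℝ)
    (L : ℕ) (R : ℕ → ℕ)
    (C : ℕ → ℕ → Fin M → ℝ)
    (G : ℕ → ℕ → ℕ → ℕ → ℝ)
    (F : Matrix (Fin M) (Fin M) ℝ)
    (idx : ℕ → Fin M) : ℕ → ℕ → ℝ
  | 0, _ => u
  | t + 1, k => ∑ i ∈ Finset.range L, ∑ j ∈ Finset.range (R t),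
      G t i j k * xi (ip (C t i) (F (idx t))) (rnnHidden M xi u L R C G F idx t j)

/-- The second difference in the first argument of `relu2` at natural numbers is a
Kronecker delta. -/
lemma relu2_second_difference (k n : ℕ) :
    relu2 (k + 1) n - 2 * relu2 k n + relu2 (k - 1) n = if n = k then 1 else 0 := by
  have hn : (0 : ℝ) ≤ n := n.cast_nonneg
  have hr (x : ℝ) : relu2 x n = max x n := max_eq_left (le_max_of_le_right hn)
  simp only [hr]
  rcases lt_trichotomy n k with h | rfl | h
  · have : (n : ℝ) + 1 ≤ k := by exact_mod_cast h
    rw [if_neg h.ne, max_eq_left (by linarith), max_eq_left (by linarith),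
      max_eq_left (by linarith)]
    ring
  · rw [if_pos rfl, max_eq_left (by linarith), max_self, max_eq_right (by linarith)]
    ring
  · have : (k : ℝ) + 1 ≤ n := by exact_mod_cast h
    rw [if_neg h.ne', max_eq_right (by linarith), max_eq_right (by linarith),
      max_eq_right (by linarith)]
    ring

lemma exists_ip_eq {M : ℕ} (F : Matrix (Fin M) (Fin M) ℝ) (hF : IsUnit F.det)
    (a : Fin M → ℝ) : ∃ c : Fin M → ℝ, ∀ m, ip c (F m) = a m := by
  refine ⟨F⁻¹.mulVec a, fun m => ?_⟩
  have h : F.mulVec (F⁻¹.mulVec a) m = a m := by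
    rw [Matrix.mulVec_mulVec, Matrix.mul_nonsing_inv F hF, Matrix.one_mulVec]
  rw [← h]
  exact Finset.sum_congr rfl fun _ _ => mul_comm _ _

/-- A single `relu2` layer with scalar state computes any function of the current template
and of a state in `{0, …, N - 1}`; the input matrix depends only on `F` and `N`. -/
lemma exists_relu2_layer {M : ℕ} (F : Matrix (Fin M) (Fin M) ℝ) (hF : IsUnit F.det) (N : ℕ)
    (φ : ℕ → Fin M → Fin N → ℝ) :
    ∃ (L : ℕ) (C : ℕ → Fin M → ℝ) (G : ℕ → ℕ → ℝ), ∀ t m (n : Fin N),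
      ∑ i ∈ Finset.range L, G t i * relu2 (ip (C i) (F m)) (n.1 : ℝ) = φ t m n := by
  choose c hc using exists_ip_eq F hF
  let e := Fintype.equivFin (Fin M × Fin N × Fin 3)
  let a (p : Fin M × Fin N × Fin 3) (m : Fin M) : ℝ :=
    if m = p.1 then p.2.1.1 + ![1, 0, -1] p.2.2 else 0
  refine ⟨Fintype.card (Fin M × Fin N × Fin 3),
    fun i => if h : i < Fintype.card _ then c (a (e.symm ⟨i, h⟩)) else 0,
    fun t i => if h : i < Fintype.card _ then
      φ t (e.symm ⟨i, h⟩).1 (e.symm ⟨i, h⟩).2.1 * ![1, -2, 1] (e.symm ⟨i, h⟩).2.2 else 0,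
    fun t m n => ?_⟩
  have hterm (m₀ : Fin M) (k : Fin N) :
      ∑ s, φ t m₀ k * ![1, -2, 1] s * relu2 (a (m₀, k, s) m) n.1
        = if m = m₀ then if n = k then φ t m₀ k else 0 else 0 := by
    have h := relu2_second_difference k.1 n.1
    simp only [Fin.sum_univ_three, a, ← Fin.ext_iff] at h ⊢
    by_cases hm : m = m₀
    · simp only [hm, if_true, Matrix.cons_val, add_zero, ← sub_eq_add_neg]
      calc _ = φ t m₀ k * (relu2 (k.1 + 1) n.1 - 2 * relu2 k.1 n.1 + relu2 (k.1 - 1) n.1) := by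
            ring
        _ = _ := by rw [h, mul_ite, mul_one, mul_zero]
    · simp only [hm, if_false, Matrix.cons_val]
      ring
  rw [Finset.sum_range, ← e.sum_comp]
  simp only [Fin.is_lt, dite_true, Fin.eta, Equiv.symm_apply_apply, hc, Fintype.sum_prod_type,
    hterm]
  simp

/-- Universality, RNN part: for any order-`T` grid tensor `H` of dimension
`M` in each mode and any invertible feature matrix `F`, there exists a generalized RNN
with rectifier nonlinearity `ξ(x,y) = max(x,y,0)` (initial hidden state `h^{(0)} = 0`,
some input dimension `L`, positive hidden ranks `R` with `R 0 = R T = 1`, matrices `C`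
and cores `G`) whose grid tensor equals `H`: for every multi-index (encoded as
`idx : ℕ → Fin M`, only the first `T` values being relevant) the final hidden state
`h^{(T)} ∈ ℝ^1` equals the corresponding entry of `H`. -/
theorem rnn_relu_universality (T M : ℕ) (hT : 1 ≤ T) (hM : 1 ≤ M)
    (F : Matrix (Fin M) (Fin M) ℝ) (hF : IsUnit F.det)
    (H : (Fin T → Fin M) → ℝ) :
    ∃ (L : ℕ) (R : ℕ → ℕ) (C : ℕ → ℕ → Fin M → ℝ) (G : ℕ → ℕ → ℕ → ℕ → ℝ),
      R 0 = 1 ∧ R T = 1 ∧ (∀ t, 1 ≤ R t) ∧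
      ∀ idx : ℕ → Fin M,
        rnnHidden M relu2 0 L R C G F idx T 0 = H (fun t => idx t.1) := by
  have : NeZero M := ⟨by lia⟩
  let e : (Fin T → Fin M) ≃ Fin (M ^ T) := finFunctionFinEquiv
  let step (t : ℕ) (m : Fin M) (n : Fin (M ^ T)) : Fin T → Fin M :=
    fun s => if s.1 = t then m else e.symm n s
  obtain ⟨L, C, G, hG⟩ := exists_relu2_layer F hF (M ^ T) (fun t m n =>
    if t + 1 < T then ((e (step t m n)).1 : ℝ) else H (step t m n))
  refine ⟨L, fun _ => 1, fun _ => C, fun t i _ _ => G t i, rfl, rfl, fun _ => le_rfl,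
    fun idx => ?_⟩
  let pre (t : ℕ) : Fin T → Fin M := fun s => if s.1 < t then idx s.1 else 0
  have hstep (t : ℕ) : step t (idx t) (e (pre t)) = pre (t + 1) := by
    funext s
    simp only [step, pre, Equiv.symm_apply_apply]
    grind
  set h := rnnHidden M relu2 0 L (fun _ => 1) (fun _ => C) (fun t i _ _ => G t i) F idx
    with h_def
  have hsucc (t : ℕ) (ht : h t 0 = (e (pre t)).1) :
      h (t + 1) 0 = if t + 1 < T then ((e (pre (t + 1))).1 : ℝ) else H (pre (t + 1)) := by
    rw [← hstep, ← hG, ← ht]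
    simp [h_def, rnnHidden]
  have hpre (t : ℕ) (ht : t < T) : h t 0 = (e (pre t)).1 := by
    induction t with
    | zero => simp [h_def, rnnHidden, e, pre, finFunctionFinEquiv]
    | succ t ih => rw [hsucc t (ih (by lia)), if_pos ht]
  obtain ⟨t, rfl⟩ : ∃ t, T = t + 1 := ⟨T - 1, by lia⟩
  rw [hsucc t (hpre t (by lia)), if_neg (lt_irrefl _)]
  congr 1
  funext s
  exact if_pos s.2
end

section
/- Let ξ : ℝ × ℝ → ℝ be an associative and commutative binary operation with a unit u (i.e. ξ(x,u) = x for all x ∈ ℝ). Fix a feature matrix F ∈ ℝ^{M×M}, and let A and B be two generalized RNNs with ξ-nonlinearity (with possibly different input dimensions and hidden ranks) having grid tensors Γ^A and Γ^B with respect to F. Then for every a, b ∈ ℝ there exists a generalized RNN with ξ-nonlinearity whose grid tensor with respect to F equals a·Γ^A + b·Γ^B. -/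
theorem sum_range_ite_lt_mul {m n : ℕ} (hmn : m ≤ n) (g f h : ℕ → ℝ)
    (hf : ∀ j < m, f j = h j) :
    ∑ j ∈ Finset.range n, (if j < m then g j else 0) * f j
      = ∑ j ∈ Finset.range m, g j * h j := by
  obtain ⟨k, rfl⟩ := Nat.exists_eq_add_of_le hmn
  rw [Finset.sum_range_add]
  simp only [Nat.not_lt.mpr (Nat.le_add_right m _), if_false, zero_mul,
    Finset.sum_const_zero, add_zero]
  refine Finset.sum_congr rfl fun j hj => ?_
  rw [if_pos (Finset.mem_range.mp hj), hf j (Finset.mem_range.mp hj)]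

theorem sum_range_ite_le_mul (p r : ℕ) (g f h : ℕ → ℝ)
    (hf : ∀ j < r, f (p + j) = h j) :
    ∑ j ∈ Finset.range (p + r), (if p ≤ j then g (j - p) else 0) * f j
      = ∑ j ∈ Finset.range r, g j * h j := by
  rw [Finset.sum_range_add, Finset.sum_eq_zero, zero_add]
  · refine Finset.sum_congr rfl fun j hj => ?_
    rw [if_pos (Nat.le_add_right p j), Nat.add_sub_cancel_left, hf j (Finset.mem_range.mp hj)]
  · intro j hj
    rw [if_neg (Nat.not_le.mpr (Finset.mem_range.mp hj)), zero_mul]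

/-- The position in the hidden state of the combined network at which the block of the second
network starts; at time `0` both networks read the same entry. -/
def blockStart (RA : ℕ → ℕ) (t : ℕ) : ℕ := if t = 0 then 0 else RA t

/-- Hidden ranks of the network combining two networks of hidden ranks `RA` and `RB`. -/
def combinedRank (T : ℕ) (RA RB : ℕ → ℕ) (t : ℕ) : ℕ :=
  if t = T then 1 else blockStart RA t + RB t

/-- Input matrices of the combined network, obtained by stacking rows. -/
def combinedInput {M : ℕ} (LA : ℕ) (CA CB : ℕ → ℕ → Fin M → ℝ) (t i : ℕ) : Fin M → ℝ :=
  if i < LA then CA t i else CB t (i - LA)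

/-- The weight of the first network in the `k`-th entry of the combined state at time `t`. -/
noncomputable def leftWeight (T : ℕ) (RA : ℕ → ℕ) (a : ℝ) (t k : ℕ) : ℝ :=
  if t = T then a else if k < RA t then 1 else 0

/-- The weight of the second network in the `k`-th entry of the combined state at time `t`. -/
noncomputable def rightWeight (T : ℕ) (RA : ℕ → ℕ) (b : ℝ) (t k : ℕ) : ℝ :=
  if t = T then b else if k < RA t then 0 else 1

/-- Block-diagonal cores of the combined network, with the linear combination taken at time `T`. -/
noncomputable def combinedCore (T LA : ℕ) (RA : ℕ → ℕ) (GA GB : ℕ → ℕ → ℕ → ℕ → ℝ) (a b : ℝ)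
    (t i j k : ℕ) : ℝ :=
  if i < LA then leftWeight T RA a (t + 1) k * (if j < RA t then GA t i j k else 0)
  else rightWeight T RA b (t + 1) k *
    (if blockStart RA t ≤ j then GB t (i - LA) (j - blockStart RA t) (k - RA (t + 1)) else 0)

section Combined

variable (T M : ℕ) (xi : ℝ → ℝ → ℝ) (u : ℝ) (F : Matrix (Fin M) (Fin M) ℝ)
  (LA : ℕ) (RA : ℕ → ℕ) (CA : ℕ → ℕ → Fin M → ℝ) (GA : ℕ → ℕ → ℕ → ℕ → ℝ)
  (LB : ℕ) (RB : ℕ → ℕ) (CB : ℕ → ℕ → Fin M → ℝ) (GB : ℕ → ℕ → ℕ → ℕ → ℝ)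
  (a b : ℝ) (idx : ℕ → Fin M)

/-- Hidden states of the combined network. -/
noncomputable def combinedHidden : ℕ → ℕ → ℝ :=
  rnnHidden M xi u (LA + LB) (combinedRank T RA RB) (combinedInput LA CA CB)
    (combinedCore T LA RA GA GB a b) F idx

theorem combinedHidden_succ {t : ℕ} (ht : t < T) (hle : RA t ≤ blockStart RA t + RB t)
    (hA : ∀ j < RA t, combinedHidden T M xi u F LA RA CA GA LB RB CB GB a b idx t j
      = rnnHidden M xi u LA RA CA GA F idx t j)
    (hB : ∀ j < RB t,
      combinedHidden T M xi u F LA RA CA GA LB RB CB GB a b idx t (blockStart RA t + j)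
        = rnnHidden M xi u LB RB CB GB F idx t j) (k : ℕ) :
    combinedHidden T M xi u F LA RA CA GA LB RB CB GB a b idx (t + 1) k
      = leftWeight T RA a (t + 1) k * rnnHidden M xi u LA RA CA GA F idx (t + 1) k
        + rightWeight T RA b (t + 1) k
          * rnnHidden M xi u LB RB CB GB F idx (t + 1) (k - RA (t + 1)) := by
  have hR : combinedRank T RA RB t = blockStart RA t + RB t := if_neg ht.ne
  unfold combinedHidden at hA hB ⊢
  rw [rnnHidden, rnnHidden, rnnHidden, Finset.sum_range_add, hR, Finset.mul_sum, Finset.mul_sum]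
  congr 1 <;> refine Finset.sum_congr rfl fun i hi => ?_
  · have hi' := Finset.mem_range.mp hi
    simp only [combinedInput, combinedCore, if_pos hi', mul_assoc]
    rw [← Finset.mul_sum]
    congr 1
    exact sum_range_ite_lt_mul hle (fun j => GA t i j k) _ _ fun j hj => by rw [← hA j hj]
  · have hi' : ¬ LA + i < LA := by omega
    simp only [combinedInput, combinedCore, if_neg hi', mul_assoc, Nat.add_sub_cancel_left]
    rw [← Finset.mul_sum]
    congr 1
    exact sum_range_ite_le_mul _ _ (fun j => GB t i j (k - RA (t + 1))) _ _
      fun j hj => by rw [← hB j hj]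

theorem combinedHidden_blocks (hRA0 : RA 0 = 1) (hRB0 : RB 0 = 1) {t : ℕ} (ht : t < T) :
    RA t ≤ blockStart RA t + RB t ∧
    (∀ j < RA t, combinedHidden T M xi u F LA RA CA GA LB RB CB GB a b idx t j
      = rnnHidden M xi u LA RA CA GA F idx t j) ∧
    ∀ j < RB t,
      combinedHidden T M xi u F LA RA CA GA LB RB CB GB a b idx t (blockStart RA t + j)
        = rnnHidden M xi u LB RB CB GB F idx t j := by
  induction t with
  | zero => exact ⟨by simp [blockStart, hRA0, hRB0], fun _ _ => rfl, fun _ _ => rfl⟩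
  | succ t ih =>
    obtain ⟨hle, hA, hB⟩ := ih (by omega)
    have step := combinedHidden_succ T M xi u F LA RA CA GA LB RB CB GB a b idx
      (by omega : t < T) hle hA hB
    refine ⟨by simp [blockStart], fun j hj => ?_, fun j _ => ?_⟩
    · rw [step]
      simp [leftWeight, rightWeight, ht.ne, hj]
    · rw [step]
      simp [leftWeight, rightWeight, blockStart, ht.ne]

end Combined

/-- Lemma on linear combinations: for an associative, commutative `ξ` with
unit `u`, given two generalized RNNs `A`, `B` with `ξ`-nonlinearity (grid tensors
`Γ^A`, `Γ^B` w.r.t. the feature matrix `F`) and any `a b : ℝ`, there is a generalized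
RNN with `ξ`-nonlinearity whose grid tensor equals `a·Γ^A + b·Γ^B`. -/
theorem rnn_linear_combination (T M : ℕ) (hT : 1 ≤ T)
    (xi : ℝ → ℝ → ℝ) (u : ℝ)
    (hassoc : ∀ x y z, xi (xi x y) z = xi x (xi y z))
    (hcomm : ∀ x y, xi x y = xi y x)
    (hu : ∀ x, xi x u = x)
    (F : Matrix (Fin M) (Fin M) ℝ)
    (LA : ℕ) (RA : ℕ → ℕ) (CA : ℕ → ℕ → Fin M → ℝ) (GA : ℕ → ℕ → ℕ → ℕ → ℝ)
    (hRA0 : RA 0 = 1) (hRAT : RA T = 1) (hRApos : ∀ t, 1 ≤ RA t)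
    (LB : ℕ) (RB : ℕ → ℕ) (CB : ℕ → ℕ → Fin M → ℝ) (GB : ℕ → ℕ → ℕ → ℕ → ℝ)
    (hRB0 : RB 0 = 1) (hRBT : RB T = 1) (hRBpos : ∀ t, 1 ≤ RB t)
    (a b : ℝ) :
    ∃ (LC : ℕ) (RC : ℕ → ℕ) (CC : ℕ → ℕ → Fin M → ℝ) (GC : ℕ → ℕ → ℕ → ℕ → ℝ),
      RC 0 = 1 ∧ RC T = 1 ∧ (∀ t, 1 ≤ RC t) ∧
      ∀ idx : ℕ → Fin M,
        rnnHidden M xi u LC RC CC GC F idx T 0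
          = a * rnnHidden M xi u LA RA CA GA F idx T 0
            + b * rnnHidden M xi u LB RB CB GB F idx T 0 := by
  obtain ⟨n, rfl⟩ : ∃ n, T = n + 1 := ⟨T - 1, by omega⟩
  refine ⟨LA + LB, combinedRank (n + 1) RA RB, combinedInput LA CA CB,
    combinedCore (n + 1) LA RA GA GB a b, ?_, if_pos rfl, fun t => ?_, fun idx => ?_⟩
  · simp [combinedRank, blockStart, hRB0]
  · have := hRBpos t
    unfold combinedRank
    split_ifs <;> omega
  · obtain ⟨hle, hA, hB⟩ := combinedHidden_blocks (n + 1) M xi u F LA RA CA GA LB RB CB GB a b idx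
      hRA0 hRB0 n.lt_succ_self
    have h := combinedHidden_succ (n + 1) M xi u F LA RA CA GA LB RB CB GB a b idx
      n.lt_succ_self hle hA hB 0
    simpa [combinedHidden, leftWeight, rightWeight] using h
end

section
/- Let F ∈ ℝ^{M×M} be invertible and let (j_1,…,j_T) ∈ {1,…,M}^T be arbitrary. Then there exists a generalized RNN with rectifier nonlinearity ξ(x,y) = max(x,y,0) whose grid tensor with respect to F equals the one-hot tensor E^{(j_1…j_T)}, defined by E^{(j_1…j_T)}_{i_1…i_T} = 1 if i_t = j_t for all t ∈ {1,…,T} and E^{(j_1…j_T)}_{i_1…i_T} = 0 otherwise. -/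
/-- Every function on the templates is realized by a row of an input matrix. -/
theorem ip_nonsing_inv_mulVec {M : ℕ} {F : Matrix (Fin M) (Fin M) ℝ} (hF : IsUnit F.det)
    (v : Fin M → ℝ) (i : Fin M) : ip (F⁻¹.mulVec v) (F i) = v i := by
  have h : F.mulVec (F⁻¹.mulVec v) = v := by
    rw [Matrix.mulVec_mulVec, Matrix.mul_nonsing_inv _ hF, Matrix.one_mulVec]
  rw [← congrFun h i]
  exact dotProduct_comm _ _

/-- Values of the inner product with the three input rows: the indicator of a mismatch with
`j`, the same indicator plus one, and the constant one. -/
noncomputable def mismatchRow {M : ℕ} (j : Fin M) (r : ℕ) (m : Fin M) : ℝ :=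
  if r = 0 then (if m = j then 0 else 1)
  else if r = 1 then (if m = j then 1 else 2)
  else 1

/-- Core weights that make the hidden state the indicator of a matching prefix. -/
noncomputable def matchCore (t i : ℕ) : ℝ :=
  if i = 0 then (if t = 0 then 0 else 1)
  else if i = 1 then -1
  else (if t = 0 then 2 else 1)

/-- After `t + 1` steps the hidden state is the indicator that the first `t + 1` templates
agree with `J`. -/
theorem rnnHidden_match {M : ℕ} {F : Matrix (Fin M) (Fin M) ℝ} (hF : IsUnit F.det)
    (J idx : ℕ → Fin M) (t k : ℕ) :
    rnnHidden M relu2 0 3 (fun _ => 1) (fun t r => F⁻¹.mulVec (mismatchRow (J t) r))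
      (fun t i _ _ => matchCore t i) F idx (t + 1) k
      = if ∀ s < t + 1, idx s = J s then 1 else 0 := by
  induction t generalizing k with
  | zero =>
    by_cases h : idx 0 = J 0 <;>
      norm_num [rnnHidden, ip_nonsing_inv_mulVec hF, Finset.sum_range_succ, mismatchRow,
        matchCore, relu2, h]
  | succ t ih =>
    rw [rnnHidden]
    simp only [Nat.forall_lt_succ_right (n := t + 1), ip_nonsing_inv_mulVec hF, ih,
      Finset.sum_range_one]
    obtain hp | hp := Classical.propComplete (∀ s < t + 1, idx s = J s) <;>
      simp only [hp] <;>
      by_cases h : idx (t + 1) = J (t + 1) <;>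
      norm_num [Finset.sum_range_succ, mismatchRow, matchCore, relu2, h]

/-- one-hot tensors: for an invertible feature matrix `F` and any
multi-index `jj`, there exists a generalized RNN with rectifier nonlinearity
`ξ(x,y) = max(x,y,0)` (initial hidden state `0`) whose grid tensor is the one-hot
tensor `E^{(j_1…j_T)}`. -/
theorem rnn_relu_one_hot (T M : ℕ) (hT : 1 ≤ T) (hM : 1 ≤ M)
    (F : Matrix (Fin M) (Fin M) ℝ) (hF : IsUnit F.det)
    (jj : Fin T → Fin M) :
    ∃ (L : ℕ) (R : ℕ → ℕ) (C : ℕ → ℕ → Fin M → ℝ) (G : ℕ → ℕ → ℕ → ℕ → ℝ),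
      R 0 = 1 ∧ R T = 1 ∧ (∀ t, 1 ≤ R t) ∧
      ∀ idx : ℕ → Fin M,
        rnnHidden M relu2 0 L R C G F idx T 0
          = if ∀ t : Fin T, idx t.1 = jj t then 1 else 0 := by
  obtain ⟨n, rfl⟩ := Nat.exists_eq_add_of_le' hT
  let J : ℕ → Fin M := fun t => if h : t < n + 1 then jj ⟨t, h⟩ else ⟨0, hM⟩
  refine ⟨3, fun _ => 1, fun t r => F⁻¹.mulVec (mismatchRow (J t) r),
    fun t i _ _ => matchCore t i, rfl, rfl, fun _ => le_rfl, fun idx => ?_⟩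
  rw [rnnHidden_match hF]
  refine if_congr ?_ rfl rfl
  rw [Fin.forall_iff]
  refine forall₂_congr fun s hs => ?_
  simp only [J, dif_pos hs]
end

section
/- Let ξ : ℝ × ℝ → ℝ be an associative and commutative binary operation with a unit u (ξ(x,u) = x for all x ∈ ℝ), and fix a feature matrix F ∈ ℝ^{M×M}. For any rank-1 generalized shallow network with ξ-nonlinearity, given by λ ∈ ℝ and vectors v^{(1)},…,v^{(T)} ∈ ℝ^M, the generalized RNN with ξ-nonlinearity with input dimension L = 1, all hidden ranks equal to 1, matrices C^{(t)} = (v^{(t)})^⊤ ∈ ℝ^{1×M}, cores G^{(t)} = 1 for t < T and G^{(T)} = λ, and initial hidden state h^{(0)} = u, has the same grid tensor: for all (i_1,…,i_T) ∈ {1,…,M}^T its output equals λ · ξ( ⟨f^{(i_1)}, v^{(1)}⟩, …, ⟨f^{(i_T)}, v^{(T)}⟩ ). -/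
/-- A fold of an associative commutative operation pulls a factor out of its initial value. -/
theorem foldr_pull_out {α β : Type*} {op : β → β → β}
    (hassoc : ∀ x y z, op (op x y) z = op x (op y z)) (hcomm : ∀ x y, op x y = op y x)
    (g : α → β) (a b : β) (l : List α) :
    l.foldr (fun t acc => op (g t) acc) (op a b)
      = op a (l.foldr (fun t acc => op (g t) acc) b) := by
  induction l with
  | nil => rfl
  | cons t l ih => rw [List.foldr_cons, List.foldr_cons, ih, ← hassoc, hcomm (g t) a, hassoc]

theorem ip_comm {M : ℕ} (a b : Fin M → ℝ) : ip a b = ip b a := dotProduct_comm a b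

/-- rank-1 shallow networks as width-1 RNNs: for an associative,
commutative `ξ` with unit `u`, the generalized RNN with input dimension `L = 1`, all
hidden ranks equal to `1`, rows `C^{(t)} = (v^{(t)})^⊤`, cores `G^{(t)} = 1` for `t < T`
and `G^{(T)} = λ`, and initial hidden state `u`, computes on every input sequence the
value `λ · ξ(⟨f^{(i_1)}, v^{(1)}⟩, …, ⟨f^{(i_T)}, v^{(T)}⟩)` (the iterated application
of `ξ`, written as a fold with unit `u`). -/
theorem rank_one_shallow_as_width_one_rnn (T M : ℕ) (hT : 1 ≤ T)
    (xi : ℝ → ℝ → ℝ) (u : ℝ)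
    (hassoc : ∀ x y z, xi (xi x y) z = xi x (xi y z))
    (hcomm : ∀ x y, xi x y = xi y x)
    (hu : ∀ x, xi x u = x)
    (F : Matrix (Fin M) (Fin M) ℝ)
    (lam : ℝ) (v : ℕ → Fin M → ℝ) :
    ∀ idx : ℕ → Fin M,
      rnnHidden M xi u 1 (fun _ => 1)
          (fun t _ m => v t m)
          (fun t _ _ _ => if t + 1 = T then lam else 1)
          F idx T 0
        = lam * (List.range T).foldr (fun t acc => xi (ip (F (idx t)) (v t)) acc) u := by
  intro idx
  have fold_succ (n : ℕ) :
      (List.range (n + 1)).foldr (fun t acc => xi (ip (F (idx t)) (v t)) acc) u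
        = xi (ip (F (idx n)) (v n))
            ((List.range n).foldr (fun t acc => xi (ip (F (idx t)) (v t)) acc) u) := by
    rw [List.range_succ, List.foldr_append]
    exact foldr_pull_out hassoc hcomm (fun t => ip (F (idx t)) (v t)) _ u _
  have hidden (n : ℕ) (hn : n < T) :
      rnnHidden M xi u 1 (fun _ => 1) (fun t _ m => v t m)
          (fun t _ _ _ => if t + 1 = T then lam else 1) F idx n 0
        = (List.range n).foldr (fun t acc => xi (ip (F (idx t)) (v t)) acc) u := by
    induction n with
    | zero => simp [rnnHidden]
    | succ n ih => simp [rnnHidden, fold_succ, ih (by omega), hn.ne, ip_comm (v n)]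
  obtain ⟨n, rfl⟩ : ∃ n, T = n + 1 := ⟨T - 1, by omega⟩
  rw [fold_succ, ← hidden n n.lt_succ_self]
  simp [rnnHidden, ip_comm (v n)]
end

section
/- Let T be even, let F ∈ ℝ^{M×M}, and let Γ be the grid tensor (with respect to F) of a generalized shallow network with rectifier nonlinearity of rank R. Then the odd–even matricization of Γ has matrix rank at most R·T·M/2. -/
/-- The odd–even matricization of an order-`2S` tensor `Γ` of dimension `M` in each
mode: rows are indexed by the tuple of entries in odd (1-based) positions, columns by the
tuple of entries in even (1-based) positions. -/
noncomputable def oddEvenMatricization (S M : ℕ) (Γ : (Fin (2 * S) → Fin M) → ℝ) :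
    Matrix (Fin S → Fin M) (Fin S → Fin M) ℝ :=
  Matrix.of fun a b => Γ (fun t =>
    if t.1 % 2 = 0 then a ⟨t.1 / 2, by have := t.isLt; omega⟩
    else b ⟨t.1 / 2, by have := t.isLt; omega⟩)

/-- The rectified maximum of the interleaving of `a` and `b` depends on `a` only through a single
pair (position, value). -/
theorem exists_fold_max_interleave_eq {S M : ℕ} (hS : 0 < S) (w : ℕ → Fin M → ℝ)
    (a : Fin S → Fin M) :
    ∃ p : Fin S × Fin M, ∀ b : Fin S → Fin M,
      (Finset.univ : Finset (Fin (2 * S))).fold max 0 (fun t =>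
        w t.1 (if t.1 % 2 = 0 then a ⟨t.1 / 2, by have := t.isLt; omega⟩
          else b ⟨t.1 / 2, by have := t.isLt; omega⟩)) =
      max (w (2 * p.1.1) p.2)
        ((Finset.univ : Finset (Fin S)).fold max 0 (fun s => w (2 * s.1 + 1) (b s))) := by
  have : Nonempty (Fin S) := ⟨⟨0, hS⟩⟩
  obtain ⟨s₀, hs₀⟩ := Finite.exists_max (fun s : Fin S => w (2 * s.1) (a s))
  refine ⟨(s₀, a s₀), fun b => le_antisymm ?_ ?_⟩
  · refine Finset.fold_max_le _ |>.2 ⟨?_, fun t _ => ?_⟩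
    · exact le_max_of_le_right (Finset.le_fold_max _ |>.2 (Or.inl le_rfl))
    · have ht := t.isLt
      by_cases h : t.1 % 2 = 0
      · rw [if_pos h]
        refine le_max_of_le_left ?_
        have h' := hs₀ ⟨t.1 / 2, by omega⟩
        rwa [show 2 * (⟨t.1 / 2, by omega⟩ : Fin S).1 = t.1 by simp only; omega] at h'
      · rw [if_neg h]
        refine le_max_of_le_right (Finset.le_fold_max _ |>.2
          (Or.inr ⟨⟨t.1 / 2, by omega⟩, Finset.mem_univ _, ?_⟩))
        rw [show 2 * (⟨t.1 / 2, by omega⟩ : Fin S).1 + 1 = t.1 by simp only; omega]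
  · refine max_le ?_ (Finset.fold_max_le _ |>.2 ⟨?_, fun s _ => ?_⟩)
    · refine Finset.le_fold_max _ |>.2
        (Or.inr ⟨⟨2 * s₀.1, by have := s₀.isLt; omega⟩, Finset.mem_univ _, ?_⟩)
      simp
    · exact Finset.le_fold_max _ |>.2 (Or.inl le_rfl)
    · refine Finset.le_fold_max _ |>.2
        (Or.inr ⟨⟨2 * s.1 + 1, by have := s.isLt; omega⟩, Finset.mem_univ _, ?_⟩)
      have h₁ : ¬ (2 * s.1 + 1) % 2 = 0 := by omega
      have h₂ : (2 * s.1 + 1) / 2 = s.1 := by omega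
      simp [h₂]

/-- rank bound for shallow networks: if `Γ` is the grid tensor of a
generalized shallow network with rectifier nonlinearity of rank `Rk` (with respect to a
feature matrix `F`), and `T = 2*S` is even, then the odd–even matricization of `Γ` has
matrix rank at most `Rk·T·M/2`. -/
theorem shallow_relu_matricization_rank_bound (S M Rk : ℕ)
    (F : Matrix (Fin M) (Fin M) ℝ) (lam : ℕ → ℝ) (v : ℕ → ℕ → Fin M → ℝ)
    (Γ : (Fin (2 * S) → Fin M) → ℝ)
    (hΓ : ∀ i : Fin (2 * S) → Fin M,
      Γ i = ∑ r ∈ Finset.range Rk,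
        lam r * (Finset.univ : Finset (Fin (2 * S))).fold max 0
          (fun t => ip (F (i t)) (v r t.1))) :
    (oddEvenMatricization S M Γ).rank ≤ Rk * (2 * S) * M / 2 := by
  rcases Nat.eq_zero_or_pos S with rfl | hS
  · have h0 : oddEvenMatricization 0 M Γ = 0 := by
      ext a b
      simp [oddEvenMatricization, hΓ]
    simp [h0]
  choose g hg using fun (r : ℕ) (a : Fin S → Fin M) =>
    exists_fold_max_interleave_eq hS (fun t m => ip (F m) (v r t)) a
  let P : Matrix (Fin S → Fin M) (Fin Rk × Fin S × Fin M) ℝ :=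
    Matrix.of fun a q => if g q.1 a = q.2 then lam q.1 else 0
  let C : Matrix (Fin Rk × Fin S × Fin M) (Fin S → Fin M) ℝ :=
    Matrix.of fun q b => max (ip (F q.2.2) (v q.1 (2 * q.2.1.1)))
      ((Finset.univ : Finset (Fin S)).fold max 0
        (fun s => ip (F (b s)) (v q.1 (2 * s.1 + 1))))
  have hPC : oddEvenMatricization S M Γ = P * C := by
    ext a b
    rw [Matrix.mul_apply, Fintype.sum_prod_type]
    simp only [oddEvenMatricization, Matrix.of_apply, hΓ, P, C, ite_mul, zero_mul,
      Finset.sum_ite_eq, Finset.mem_univ, if_true]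
    rw [← Fin.sum_univ_eq_sum_range (fun r => lam r * _)]
    exact Finset.sum_congr rfl fun r _ => congrArg _ (hg r a b)
  calc (oddEvenMatricization S M Γ).rank ≤ P.rank := hPC ▸ Matrix.rank_mul_le_left P C
    _ ≤ Fintype.card (Fin Rk × Fin S × Fin M) := P.rank_le_card_width
    _ = Rk * (2 * S) * M / 2 := by
      rw [show Rk * (2 * S) * M = 2 * (Rk * (S * M)) by ring]
      simp
end

section
/- Let ξ : ℝ × ℝ → ℝ be any binary operation with a unit u, and fix a feature matrix F ∈ ℝ^{M×M}. Let A and B be generalized RNNs with ξ-nonlinearity with input dimensions L_A, L_B, hidden ranks R_{t,A}, R_{t,B}, matrices C_A^{(t)}, C_B^{(t)} and cores G_A^{(t)}, G_B^{(t)}, and let a, b ∈ ℝ. Define a generalized RNN C with input dimension L_A + L_B, hidden ranks R_{t,A} + R_{t,B} for 0 < t < T, matrices C_C^{(t)} obtained by stacking C_A^{(t)} on top of C_B^{(t)}, core slices [G_C^{(1)}]_{i,:,:} = [ [G_A^{(1)}]_{i,:,:} 0 ] for i ≤ L_A and [ 0 [G_B^{(1)}]_{i-L_A,:,:} ] for i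 > L_A, block-diagonal core slices [G_C^{(t)}]_{i,:,:} = diag([G_A^{(t)}]_{i,:,:}, 0) for i ≤ L_A and diag(0, [G_B^{(t)}]_{i-L_A,:,:}) for L_A < i ≤ L_A+L_B when 1 < t < T, and final core slices [G_C^{(T)}]_{i,:,:} stacking a·[G_A^{(T)}]_{i,:,:} over 0 for i ≤ L_A and 0 over b·[G_B^{(T)}]_{i-L_A,:,:} for i > L_A. Then for every multi-index (i_1,…,i_T) ∈ {1,…,M}^T, the hidden states satisfy h_C^{(t)} = (h_A^{(t)}, h_B^{(t)}) (concatenation) for 0 < t < T and h_C^{(T)} = a·h_A^{(T)} + b·h_B^{(T)}. -/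
/-- Hidden ranks of the sum-network `C`: `R_{0,C} = R_{T,C} = 1` and
`R_{t,C} = R_{t,A} + R_{t,B}` for `0 < t < T`. -/
def rcRank (T : ℕ) (RA RB : ℕ → ℕ) (t : ℕ) : ℕ :=
  if t = 0 ∨ t = T then 1 else RA t + RB t

/-- Input matrices of the sum-network `C`: `C_C^{(t)}` is `C_A^{(t)}` stacked on top of
`C_B^{(t)}`. -/
def ccMat (M LA : ℕ) (CA CB : ℕ → ℕ → Fin M → ℝ) (t i : ℕ) : Fin M → ℝ :=
  if i < LA then CA t i else CB t (i - LA)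

/-- Cores of the sum-network `C` (0-based: index `t` is the core `G^{(t+1)}`):
first core slices `[ G_A 0 ]` resp. `[ 0 G_B ]`, middle core slices block-diagonal
`diag(G_A, 0)` resp. `diag(0, G_B)`, and final core slices `[a·G_A ; 0]` resp.
`[0 ; b·G_B]`. -/
def gcCore (T LA : ℕ) (RA : ℕ → ℕ) (GA GB : ℕ → ℕ → ℕ → ℕ → ℝ) (a b : ℝ)
    (t i j k : ℕ) : ℝ :=
  if i < LA then
    (if t + 1 = T then (if j < RA t then a * GA t i j k else 0)
     else if t = 0 then (if k < RA 1 then GA t i j k else 0)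
     else (if j < RA t ∧ k < RA (t + 1) then GA t i j k else 0))
  else
    (if t + 1 = T then (if RA t ≤ j then b * GB t (i - LA) (j - RA t) k else 0)
     else if t = 0 then (if RA 1 ≤ k then GB t (i - LA) j (k - RA 1) else 0)
     else (if RA t ≤ j ∧ RA (t + 1) ≤ k then
             GB t (i - LA) (j - RA t) (k - RA (t + 1)) else 0))

section SumNetwork

variable {T M : ℕ} {xi : ℝ → ℝ → ℝ} {u : ℝ} {F : Matrix (Fin M) (Fin M) ℝ}
  {LA : ℕ} {RA : ℕ → ℕ} {CA : ℕ → ℕ → Fin M → ℝ} {GA : ℕ → ℕ → ℕ → ℕ → ℝ}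
  {LB : ℕ} {RB : ℕ → ℕ} {CB : ℕ → ℕ → Fin M → ℝ} {GB : ℕ → ℕ → ℕ → ℕ → ℝ}
  {a b : ℝ} {idx : ℕ → Fin M}

/-- One step of the sum-network, with the sum over the stacked inputs split into its two blocks. -/
theorem rnnHidden_sumNetwork_succ (t k : ℕ) :
    rnnHidden M xi u (LA + LB) (rcRank T RA RB) (ccMat M LA CA CB)
        (gcCore T LA RA GA GB a b) F idx (t + 1) k
      = (∑ i ∈ Finset.range LA, ∑ j ∈ Finset.range (rcRank T RA RB t),
          gcCore T LA RA GA GB a b t i j k * xi (ip (CA t i) (F (idx t)))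
            (rnnHidden M xi u (LA + LB) (rcRank T RA RB) (ccMat M LA CA CB)
              (gcCore T LA RA GA GB a b) F idx t j))
        + ∑ i ∈ Finset.range LB, ∑ j ∈ Finset.range (rcRank T RA RB t),
          gcCore T LA RA GA GB a b t (LA + i) j k * xi (ip (CB t i) (F (idx t)))
            (rnnHidden M xi u (LA + LB) (rcRank T RA RB) (ccMat M LA CA CB)
              (gcCore T LA RA GA GB a b) F idx t j) := by
  rw [rnnHidden, Finset.sum_range_add]
  congr 1
  · refine Finset.sum_congr rfl fun i hi => ?_
    simp [ccMat, Finset.mem_range.mp hi]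
  · simp [ccMat]

/-- The hidden state of the sum-network at time `t` is the concatenation of those of its parts. -/
def IsConcatState (T M : ℕ) (xi : ℝ → ℝ → ℝ) (u : ℝ) (F : Matrix (Fin M) (Fin M) ℝ)
    (LA : ℕ) (RA : ℕ → ℕ) (CA : ℕ → ℕ → Fin M → ℝ) (GA : ℕ → ℕ → ℕ → ℕ → ℝ)
    (LB : ℕ) (RB : ℕ → ℕ) (CB : ℕ → ℕ → Fin M → ℝ) (GB : ℕ → ℕ → ℕ → ℕ → ℝ)
    (a b : ℝ) (idx : ℕ → Fin M) (t : ℕ) : Prop :=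
  (∀ j, j < RA t →
    rnnHidden M xi u (LA + LB) (rcRank T RA RB) (ccMat M LA CA CB)
        (gcCore T LA RA GA GB a b) F idx t j
      = rnnHidden M xi u LA RA CA GA F idx t j) ∧
  (∀ j, RA t ≤ j → j < RA t + RB t →
    rnnHidden M xi u (LA + LB) (rcRank T RA RB) (ccMat M LA CA CB)
        (gcCore T LA RA GA GB a b) F idx t j
      = rnnHidden M xi u LB RB CB GB F idx t (j - RA t))

theorem isConcatState_one (hT : 1 < T) (hRA0 : RA 0 = 1) (hRB0 : RB 0 = 1) :
    IsConcatState T M xi u F LA RA CA GA LB RB CB GB a b idx 1 := by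
  have hT' : ¬ 1 = T := by omega
  constructor
  · intro k hk
    rw [rnnHidden_sumNetwork_succ, rnnHidden]
    simp +contextual [rcRank, hRA0, gcCore, hT', hk, hk.not_ge, rnnHidden,
      Finset.sum_congr]
  · intro k hk _
    rw [rnnHidden_sumNetwork_succ, rnnHidden]
    simp +contextual [rcRank, hRB0, gcCore, hT', hk, hk.not_gt, rnnHidden,
      Finset.sum_congr]

/-- A sum over a concatenated state of rank `m + n` whose coefficients vanish on the second
block. -/
theorem sum_range_add_eq_left {m n : ℕ} {f g : ℕ → ℝ} (hl : ∀ j < m, f j = g j)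
    (hr : ∀ j < n, f (m + j) = 0) :
    ∑ j ∈ Finset.range (m + n), f j = ∑ j ∈ Finset.range m, g j := by
  rw [Finset.sum_range_add, Finset.sum_eq_zero fun j hj => hr j (Finset.mem_range.mp hj),
    add_zero]
  exact Finset.sum_congr rfl fun j hj => hl j (Finset.mem_range.mp hj)

/-- A sum over a concatenated state of rank `m + n` whose coefficients vanish on the first
block. -/
theorem sum_range_add_eq_right {m n : ℕ} {f g : ℕ → ℝ} (hl : ∀ j < m, f j = 0)
    (hr : ∀ j < n, f (m + j) = g j) :
    ∑ j ∈ Finset.range (m + n), f j = ∑ j ∈ Finset.range n, g j := by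
  rw [Finset.sum_range_add, Finset.sum_eq_zero fun j hj => hl j (Finset.mem_range.mp hj),
    zero_add]
  exact Finset.sum_congr rfl fun j hj => hr j (Finset.mem_range.mp hj)

theorem IsConcatState.succ {t : ℕ} (ht : 0 < t) (hT : t + 1 < T)
    (h : IsConcatState T M xi u F LA RA CA GA LB RB CB GB a b idx t) :
    IsConcatState T M xi u F LA RA CA GA LB RB CB GB a b idx (t + 1) := by
  have ht0 : t ≠ 0 := ht.ne'
  have htT : t ≠ T := by omega
  have htT' : t + 1 ≠ T := hT.ne
  have hR : rcRank T RA RB t = RA t + RB t := by simp [rcRank, ht0, htT]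
  constructor
  · intro k hk
    rw [rnnHidden_sumNetwork_succ, hR, rnnHidden]
    rw [add_eq_left.mpr (by simp [gcCore, ht0, htT', hk.not_ge])]
    refine Finset.sum_congr rfl fun i hi => ?_
    have hi := Finset.mem_range.mp hi
    refine sum_range_add_eq_left (fun j hj => ?_) fun j _ => ?_
    · simp [gcCore, hi, ht0, htT', hj, hk, h.1 j hj]
    · simp [gcCore, hi, ht0, htT']
  · intro k hk _
    rw [rnnHidden_sumNetwork_succ, hR, rnnHidden]
    rw [add_eq_right.mpr (Finset.sum_eq_zero fun i hi => by
      simp [gcCore, Finset.mem_range.mp hi, ht0, htT', hk.not_gt])]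
    refine Finset.sum_congr rfl fun i _ => ?_
    refine sum_range_add_eq_right (fun j hj => ?_) fun j hj => ?_
    · simp [gcCore, ht0, htT', hj.not_ge]
    · simp [gcCore, ht0, htT', hk, h.2 (RA t + j) (by omega) (by omega)]

theorem IsConcatState.final {t : ℕ} (ht : 0 < t) (hT : t + 1 = T)
    (h : IsConcatState T M xi u F LA RA CA GA LB RB CB GB a b idx t) (k : ℕ) :
    rnnHidden M xi u (LA + LB) (rcRank T RA RB) (ccMat M LA CA CB)
        (gcCore T LA RA GA GB a b) F idx (t + 1) k
      = a * rnnHidden M xi u LA RA CA GA F idx (t + 1) k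
        + b * rnnHidden M xi u LB RB CB GB F idx (t + 1) k := by
  have hR : rcRank T RA RB t = RA t + RB t := by
    simp [rcRank, ht.ne', show t ≠ T by omega]
  rw [rnnHidden_sumNetwork_succ, hR]
  simp only [rnnHidden, Finset.mul_sum]
  congr 1
  · refine Finset.sum_congr rfl fun i hi => ?_
    have hi := Finset.mem_range.mp hi
    refine sum_range_add_eq_left (fun j hj => ?_) fun j _ => ?_
    · simp [gcCore, hi, hT, hj, h.1 j hj, mul_assoc]
    · simp [gcCore, hi, hT]
  · refine Finset.sum_congr rfl fun i _ => ?_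
    refine sum_range_add_eq_right (fun j hj => ?_) fun j hj => ?_
    · simp [gcCore, hT, hj.not_ge]
    · simp [gcCore, hT, h.2 (RA t + j) (by omega) (by omega), mul_assoc]

end SumNetwork

/-- block construction for linear combinations: for any `ξ` with unit
`u`, two generalized RNNs `A`, `B` with `ξ`-nonlinearity and `a b : ℝ`, the network
`C` with input dimension `L_A + L_B`, hidden ranks `R_{t,A} + R_{t,B}` for `0 < t < T`,
stacked input matrices and the block cores `gcCore` satisfies, on every input sequence:
`h_C^{(t)} = (h_A^{(t)}, h_B^{(t)})` (concatenation) for `0 < t < T`, and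
`h_C^{(T)} = a·h_A^{(T)} + b·h_B^{(T)}`. -/
theorem rnn_sum_block_construction (T M : ℕ) (hT : 2 ≤ T)
    (xi : ℝ → ℝ → ℝ) (u : ℝ) (hu : ∀ x, xi x u = x)
    (F : Matrix (Fin M) (Fin M) ℝ)
    (LA : ℕ) (RA : ℕ → ℕ) (CA : ℕ → ℕ → Fin M → ℝ) (GA : ℕ → ℕ → ℕ → ℕ → ℝ)
    (hRA0 : RA 0 = 1) (hRAT : RA T = 1)
    (LB : ℕ) (RB : ℕ → ℕ) (CB : ℕ → ℕ → Fin M → ℝ) (GB : ℕ → ℕ → ℕ → ℕ → ℝ)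
    (hRB0 : RB 0 = 1) (hRBT : RB T = 1)
    (a b : ℝ) :
    ∀ idx : ℕ → Fin M,
      (∀ t, 0 < t → t < T →
        (∀ j, j < RA t →
          rnnHidden M xi u (LA + LB) (rcRank T RA RB) (ccMat M LA CA CB)
              (gcCore T LA RA GA GB a b) F idx t j
            = rnnHidden M xi u LA RA CA GA F idx t j) ∧
        (∀ j, RA t ≤ j → j < RA t + RB t →
          rnnHidden M xi u (LA + LB) (rcRank T RA RB) (ccMat M LA CA CB)
              (gcCore T LA RA GA GB a b) F idx t j
            = rnnHidden M xi u LB RB CB GB F idx t (j - RA t))) ∧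
      rnnHidden M xi u (LA + LB) (rcRank T RA RB) (ccMat M LA CA CB)
          (gcCore T LA RA GA GB a b) F idx T 0
        = a * rnnHidden M xi u LA RA CA GA F idx T 0
          + b * rnnHidden M xi u LB RB CB GB F idx T 0 := by
  intro idx
  have concat : ∀ t, 0 < t → t < T →
      IsConcatState T M xi u F LA RA CA GA LB RB CB GB a b idx t := by
    intro t ht
    induction t, ht using Nat.le_induction with
    | base => exact fun h => isConcatState_one h hRA0 hRB0
    | succ t ht ih => exact fun h => (ih (by omega)).succ ht h
  refine ⟨concat, ?_⟩
  obtain ⟨t, rfl⟩ : ∃ t, T = t + 1 := ⟨T - 1, by omega⟩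
  exact (concat t (by omega) (by omega)).final (by omega) rfl 0
end
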